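/- The sumset L₀ + U equals ℕ \ {F_n − 1 : n ≥ 1 and n odd}; that is, a natural number m fails to be expressible as m = a + b with a ∈ L₀ and b ∈ U if and only if m = F_n − 1 for some odd integer n ≥ 1. -/

import Mathlib

noncomputable def phi : ℝ := (1 + Real.sqrt 5) / 2

/-- The lower Wythoff set `L = {⌊i·φ⌋ : i ≥ 1}`. -/
def lowerWythoff : Set ℕ := {n | ∃ i : ℕ, 1 ≤ i ∧ n = ⌊(i : ℝ) * phi⌋₊}

/-- The upper Wythoff set `U = {⌊i·φ²⌋ : i ≥ 1}`. -/
def upperWythoff : Set ℕ := {n | ∃ i : ℕ, 1 ≤ i ∧ n = ⌊(i : ℝ) * phi ^ 2⌋₊}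

lemma phi_eq_goldenRatio : phi = Real.goldenRatio := rfl

lemma phi_bounds : 1.6 < phi ∧ phi < 1.65 := by
  have h := Real.sq_sqrt (show (0 : ℝ) ≤ 5 by norm_num)
  have h0 := Real.sqrt_nonneg 5
  unfold phi
  constructor <;> nlinarith

lemma phi_sq : phi ^ 2 = phi + 1 := by
  rw [phi_eq_goldenRatio, Real.goldenRatio_sq]

/-- The golden ratio conjugate `φ⁻¹ = φ - 1`. -/
noncomputable def phiInv : ℝ := phi - 1

lemma phiInv_bounds : 0.6 < phiInv ∧ phiInv < 0.65 := by
  have := phi_bounds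
  unfold phiInv
  constructor <;> linarith

lemma phiInv_pos : 0 < phiInv := by linarith [phiInv_bounds.1]

lemma phiInv_sq : phiInv ^ 2 = 1 - phiInv := by
  unfold phiInv
  linear_combination phi_sq

lemma phi_mul_phiInv : phi * phiInv = 1 := by
  unfold phiInv
  linear_combination phi_sq

lemma eq_zero_of_mul_phiInv_eq {p q : ℤ} (h : p * phiInv = q) : p = 0 := by
  by_contra hp
  have hirr : Irrational (p * phiInv) := by
    have : Irrational phiInv := by
      simpa [phiInv, phi_eq_goldenRatio] using Real.goldenRatio_irrational.sub_natCast 1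
    exact this.intCast_mul hp
  exact hirr ⟨q, by simp [h]⟩

lemma mem_lowerWythoff_union_zero {n : ℕ} :
    n ∈ lowerWythoff ∪ {0} ↔ ∃ i : ℤ, n * phiInv ≤ i ∧ i < (n + 1) * phiInv := by
  have hα := phiInv_pos
  have hφ : 0 < phi := by linarith [phi_bounds.1]
  have hmul := phi_mul_phiInv
  have key (i : ℕ) : n = ⌊(i : ℝ) * phi⌋₊ ↔ n * phiInv ≤ i ∧ i < (n + 1) * phiInv := by
    rw [eq_comm, Nat.floor_eq_iff (by positivity), ← mul_le_mul_iff_left₀ hα,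
      ← mul_lt_mul_iff_left₀ hα, mul_assoc, hmul, mul_one]
  constructor
  · rintro (⟨i, -, hi⟩ | rfl)
    · exact ⟨i, by exact_mod_cast (key i).1 hi⟩
    · exact ⟨0, by simp [hα]⟩
  · rintro ⟨i, hi⟩
    have h0 : (0 : ℝ) ≤ i := le_trans (by positivity) hi.1
    lift i to ℕ using by exact_mod_cast h0
    rcases Nat.eq_zero_or_pos i with rfl | hpos
    · right
      have : (n : ℝ) ≤ 0 := by
        have := hi.1
        push_cast at this
        exact nonpos_of_mul_nonpos_left this hα
      exact Nat.le_zero.1 (by exact_mod_cast this)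
    · exact Or.inl ⟨i, hpos, (key i).2 (by exact_mod_cast hi)⟩

lemma mem_upperWythoff {n : ℕ} :
    n ∈ upperWythoff ↔ 1 ≤ n ∧ ∃ q : ℤ, (n + 1) * phiInv - 1 < q ∧ q ≤ n * phiInv := by
  have hα := phiInv_pos
  have hα2 : 0 < phiInv ^ 2 := by positivity
  have hφ : 0 < phi := by linarith [phi_bounds.1]
  have hmul : phi ^ 2 * phiInv ^ 2 = 1 := by rw [← mul_pow, phi_mul_phiInv, one_pow]
  have key (i : ℕ) : n = ⌊(i : ℝ) * phi ^ 2⌋₊ ↔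
      (n + 1) * phiInv - 1 < ((n - i : ℤ) : ℝ) ∧ ((n - i : ℤ) : ℝ) ≤ n * phiInv := by
    rw [eq_comm, Nat.floor_eq_iff (by positivity), ← mul_le_mul_iff_left₀ hα2,
      ← mul_lt_mul_iff_left₀ hα2, mul_assoc, hmul, mul_one, phiInv_sq]
    push_cast
    constructor <;> rintro ⟨h1, h2⟩ <;> constructor <;> linarith
  constructor
  · rintro ⟨i, hi1, hi⟩
    refine ⟨?_, n - i, (key i).1 hi⟩
    rw [hi]
    have : (1 : ℝ) ≤ i := by exact_mod_cast hi1
    refine Nat.le_floor ?_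
    have := phi_bounds.1
    push_cast
    rw [phi_sq]
    nlinarith
  · rintro ⟨hn, q, hq⟩
    have hn' : (1 : ℝ) ≤ n := by exact_mod_cast hn
    have hlt : (0 : ℝ) < ((n - q : ℤ) : ℝ) := by
      push_cast
      nlinarith [phiInv_bounds.2]
    have hlt' : 0 < (n : ℤ) - q := by exact_mod_cast hlt
    obtain ⟨i, hi⟩ := Int.eq_ofNat_of_zero_le hlt'.le
    refine ⟨i, by omega, (key i).2 ?_⟩
    rwa [show (n - i : ℤ) = q by omega]

lemma fib_mul_phiInv_sub (n : ℕ) :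
    Nat.fib (n + 1) * phiInv - Nat.fib n = (-1) ^ n * phiInv ^ (n + 1) := by
  induction n using Nat.twoStepInduction with
  | zero => simp
  | one =>
    simp only [Nat.fib_add_two, Nat.fib_one, Nat.fib_zero]
    push_cast
    linear_combination phiInv_sq
  | more n h1 h2 =>
    rw [Nat.fib_add_two (n := n + 1), Nat.fib_add_two (n := n)] at *
    push_cast at *
    linear_combination h1 + h2 - (-1) ^ n * phiInv ^ (n + 1) * phiInv_sq

lemma fib_odd_mul_phiInv (n : ℕ) :
    Nat.fib (2 * n + 1) * phiInv = Nat.fib (2 * n) + phiInv ^ (2 * n + 1) := by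
  have := fib_mul_phiInv_sub (2 * n)
  rw [pow_mul] at this
  norm_num at this
  linarith

lemma fib_even_mul_phiInv (n : ℕ) :
    Nat.fib (2 * n + 2) * phiInv = Nat.fib (2 * n + 1) - phiInv ^ (2 * n + 2) := by
  have := fib_mul_phiInv_sub (2 * n + 1)
  rw [pow_succ, pow_mul] at this
  norm_num at this
  linarith

lemma fib_cassini_odd (n : ℕ) :
    (Nat.fib (2 * n + 1) : ℤ) ^ 2 - Nat.fib (2 * n + 2) * Nat.fib (2 * n) = 1 := by
  induction n with
  | zero => simp
  | succ n ih =>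
    rw [show 2 * (n + 1) = 2 * n + 2 by ring, Nat.fib_add_two (n := 2 * n + 2),
      Nat.fib_add_two (n := 2 * n + 1)]
    rw [Nat.fib_add_two (n := 2 * n)] at *
    push_cast at *
    linear_combination ih

/-- Best one-sided approximation: a positive value of `j * φ⁻¹ - i` with `0 < j < F_{2n+3}` is
at least `F_{2n+1} * φ⁻¹ - F_{2n}`. -/
lemma phiInv_pow_le_of_pos {n : ℕ} {j i : ℤ} (hj0 : 0 < j) (hj : j < Nat.fib (2 * n + 3))
    (hpos : 0 < j * phiInv - i) : phiInv ^ (2 * n + 1) ≤ j * phiInv - i := by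
  by_contra! hlt
  have hα := phiInv_pos
  have hP : 0 < phiInv ^ (2 * n + 1) := by positivity
  have hdet := fib_cassini_odd n
  have hodd := fib_odd_mul_phiInv n
  have heven := fib_even_mul_phiInv n
  have hfib : (Nat.fib (2 * n + 3) : ℤ) = Nat.fib (2 * n + 1) + Nat.fib (2 * n + 2) := by
    exact_mod_cast Nat.fib_add_two (n := 2 * n + 1)
  have hF : (0 : ℤ) < Nat.fib (2 * n + 1) := by exact_mod_cast Nat.fib_pos.2 (by omega)
  have hG : (0 : ℤ) < Nat.fib (2 * n + 2) := by exact_mod_cast Nat.fib_pos.2 (by omega)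
  set F : ℕ := Nat.fib (2 * n + 1)
  set G : ℕ := Nat.fib (2 * n + 2)
  set E : ℕ := Nat.fib (2 * n)
  obtain ⟨a, b, rfl, rfl⟩ : ∃ a b : ℤ, j = a * F + b * G ∧ i = a * E + b * F :=
    ⟨j * F - i * G, i * F - j * E, by linear_combination -j * hdet, by linear_combination -i * hdet⟩
  have hval : ((a * F + b * G : ℤ) : ℝ) * phiInv - ((a * E + b * F : ℤ) : ℝ)
      = phiInv ^ (2 * n + 1) * (a - b * phiInv) := by
    push_cast
    linear_combination a * hodd + b * heven
  rw [hval] at hpos hlt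
  have h1 : 0 < (a : ℝ) - b * phiInv := pos_of_mul_pos_right hpos hP.le
  have h2 : (a : ℝ) - b * phiInv < 1 := by nlinarith
  rcases lt_trichotomy b 0 with hb | rfl | hb
  · have hb' : (b : ℝ) < 0 := by exact_mod_cast hb
    have : (a : ℝ) < 1 := by nlinarith
    have ha : a < 1 := by exact_mod_cast this
    nlinarith
  · simp only [Int.cast_zero, zero_mul, sub_zero] at h1 h2
    have : 0 < a := by exact_mod_cast h1
    have : a < 1 := by exact_mod_cast h2
    omega
  · have hb' : (0 : ℝ) < b := by exact_mod_cast hb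
    have : (0 : ℝ) < a := by nlinarith
    have ha : 0 < a := by exact_mod_cast this
    nlinarith

lemma exists_fib_odd_le_lt {N : ℕ} (hN : 1 ≤ N) :
    ∃ n, Nat.fib (2 * n + 1) ≤ N ∧ N < Nat.fib (2 * n + 3) := by
  have hex : ∃ n, N < Nat.fib (2 * n + 1) :=
    ⟨N + 2, by
      have := Nat.le_fib_self (n := 2 * (N + 2) + 1) (by omega)
      omega⟩
  obtain ⟨n, hn⟩ : ∃ n, Nat.find hex = n + 1 := by
    refine Nat.exists_eq_succ_of_ne_zero fun h0 => ?_
    have := Nat.find_spec hex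
    rw [h0] at this
    simp at this
    omega
  refine ⟨n, not_lt.1 (Nat.find_min hex (by omega)), ?_⟩
  have := Nat.find_spec hex
  rwa [hn] at this

lemma not_exists_add_of_fib_odd {m n : ℕ} (hm : m + 1 = Nat.fib (2 * n + 1)) :
    ¬∃ a ∈ lowerWythoff ∪ {0}, ∃ b ∈ upperWythoff, m = a + b := by
  rintro ⟨a, ha, b, hb, rfl⟩
  obtain ⟨i, hi1, hi2⟩ := mem_lowerWythoff_union_zero.1 ha
  obtain ⟨hb1, q, hq1, hq2⟩ := mem_upperWythoff.1 hb
  cases n with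
  | zero => simp at hm; omega
  | succ n =>
    have hα := phiInv_pos
    have hα1 : phiInv < 1 := by linarith [phiInv_bounds.2]
    have hodd := fib_odd_mul_phiInv (n + 1)
    rw [← hm] at hodd
    push_cast at hodd
    have hP : 0 < phiInv ^ (2 * (n + 1) + 1) := by positivity
    have hPlt : phiInv ^ (2 * (n + 1) + 1) < phiInv ^ (2 * n + 1) :=
      pow_lt_pow_right_of_lt_one₀ hα hα1 (by omega)
    have hP1 : phiInv ^ (2 * (n + 1) + 1) < 1 := pow_lt_one₀ hα.le hα1 (by omega)
    have hiq : i + q = Nat.fib (2 * (n + 1)) := by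
      have h1 : ((i + q : ℤ) : ℝ) < ((Nat.fib (2 * (n + 1)) + 1 : ℤ) : ℝ) := by
        push_cast
        linarith
      have h2 : ((Nat.fib (2 * (n + 1)) : ℤ) : ℝ) < ((i + q + 1 : ℤ) : ℝ) := by
        push_cast
        linarith
      have h1' := Int.cast_lt.1 h1
      have h2' := Int.cast_lt.1 h2
      omega
    have hiq' : (i : ℝ) + q = Nat.fib (2 * (n + 1)) := by exact_mod_cast hiq
    have hne : (q : ℝ) ≠ b * phiInv := fun h => by
      have := eq_zero_of_mul_phiInv_eq (p := b) (q := q) (by simp [h])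
      omega
    have hlow := phiInv_pow_le_of_pos (n := n) (j := b) (i := q) (by omega)
      (by rw [show 2 * n + 3 = 2 * (n + 1) + 1 by ring]; omega)
      (by have := lt_of_le_of_ne hq2 hne; push_cast; linarith)
    push_cast at hlow
    linarith

lemma exists_add_of_ne_fib_odd {m : ℕ} (hm : ∀ n, m + 1 ≠ Nat.fib (2 * n + 1)) :
    ∃ a ∈ lowerWythoff ∪ {0}, ∃ b ∈ upperWythoff, m = a + b := by
  obtain ⟨n, hle, hlt⟩ := exists_fib_odd_le_lt (N := m + 1) (by omega)
  have hle' := lt_of_le_of_ne hle (hm n).symm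
  obtain ⟨hb1, hb2⟩ := phiInv_bounds
  have hsq := phiInv_sq
  have hα := phiInv_pos
  have hm2 : 2 ≤ m := by
    have h0 := hm 0
    have h1 := hm 1
    simp [Nat.fib_add_two] at h0 h1
    omega
  cases n with
  | zero => simp [Nat.fib_add_two] at hlt; omega
  | succ n =>
    have hr1 := Int.floor_le (((m + 1 : ℕ) : ℝ) * phiInv)
    have hr2 := Int.lt_floor_add_one (((m + 1 : ℕ) : ℝ) * phiInv)
    set r := ⌊((m + 1 : ℕ) : ℝ) * phiInv⌋
    push_cast at hr1 hr2
    rcases lt_or_ge ((m + 1) * phiInv - r) (1 - phiInv) with h | h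
    · have hodd := fib_odd_mul_phiInv (n + 1)
      have hfp : 0 < Nat.fib (2 * (n + 1) + 1) := Nat.fib_pos.2 (by omega)
      set F := Nat.fib (2 * (n + 1) + 1)
      set E := Nat.fib (2 * (n + 1))
      have hP : 0 < phiInv ^ (2 * (n + 1) + 1) := by positivity
      have hP2 : phiInv ^ (2 * (n + 1) + 1) < phiInv ^ 2 :=
        pow_lt_pow_right_of_lt_one₀ hα (by linarith) (by omega)
      have hne : (r : ℝ) ≠ (m + 1) * phiInv := fun h => by
        have := eq_zero_of_mul_phiInv_eq (p := m + 1) (q := r) (by simp [h])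
        omega
      have hlow := phiInv_pow_le_of_pos (n := n + 1) (j := m + 1) (i := r) (by omega)
        (by omega) (by have := lt_of_le_of_ne hr1 hne; push_cast; linarith)
      push_cast at hlow
      have hne2 : (m + 1) * phiInv - r ≠ phiInv ^ (2 * (n + 1) + 1) := fun h => by
        have := eq_zero_of_mul_phiInv_eq (p := m + 1 - F) (q := r - E)
          (by push_cast; linarith)
        omega
      have hlow' := lt_of_le_of_ne hlow hne2.symm
      have hcast : ((m - F : ℕ) : ℝ) = m - F := by rw [Nat.cast_sub (by omega)]
      refine ⟨m - F, mem_lowerWythoff_union_zero.2 ⟨r - E, ?_, ?_⟩, F,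
        mem_upperWythoff.2 ⟨hfp, E, ?_, ?_⟩, by omega⟩ <;> push_cast <;>
        (try rw [hcast]) <;> linarith
    · rcases lt_or_ge ((m + 1) * phiInv - r) phiInv with h' | h'
      · have hcast : ((m - 2 : ℕ) : ℝ) = m - 2 := by rw [Nat.cast_sub hm2]; norm_num
        refine ⟨m - 2, mem_lowerWythoff_union_zero.2 ⟨r - 1, ?_, ?_⟩, 2,
          mem_upperWythoff.2 ⟨by norm_num, 1, ?_, ?_⟩, by omega⟩ <;> push_cast <;>
          (try rw [hcast]) <;> linarith
      · exact ⟨0, by simp, m, mem_upperWythoff.2 ⟨by omega, r, by linarith, by linarith⟩,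
          by omega⟩

/-- Theorem 3.5(ii): `L₀ + U = ℕ \ {F_k - 1 : k ≥ 1, k odd}`. -/
theorem lower0_add_upper (m : ℕ) :
    (¬∃ a ∈ lowerWythoff ∪ {0}, ∃ b ∈ upperWythoff, m = a + b) ↔
      ∃ k : ℕ, 1 ≤ k ∧ Odd k ∧ m + 1 = Nat.fib k := by
  constructor
  · intro h
    by_contra! hk
    exact h (exists_add_of_ne_fib_odd fun n => hk _ (by omega) ⟨n, rfl⟩)
  · rintro ⟨k, -, ⟨n, rfl⟩, hk⟩
    exact not_exists_add_of_fib_odd hk
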